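/- Let (X, Σ, μ) be a measure space such that μ has no atoms and there exists a measurable set E with 0 < μ(E) < ∞. Let θ be an N-function that fails the Δ₂-condition, i.e., for every k > 0 and every x₀ ≥ 0 there exists x ≥ x₀ with θ(2x) > k θ(x). Then there exists a measurable function f : X → ℝ such that ∫ θ(|f|) dμ < ∞ but ∫ θ(2|f|) dμ = ∞; in particular, the Orlicz class {f measurable : ∫ θ(|f|) dμ < ∞} is not a linear space. -/

import Mathlib

open MeasureTheory Filter Topology ENNReal

/-- An N-function: continuous, convex, even, vanishing at 0, with
`θ(u)/u → 0` as `u → 0⁺` and `θ(u)/u → ∞` as `u → ∞`. -/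
def IsNFunction (θ : ℝ → ℝ) : Prop :=
  Continuous θ ∧ ConvexOn ℝ Set.univ θ ∧ (∀ x, θ (-x) = θ x) ∧ θ 0 = 0 ∧
  Tendsto (fun u => θ u / u) (nhdsWithin 0 (Set.Ioi 0)) (nhds 0) ∧
  Tendsto (fun u => θ u / u) atTop atTop

/-- The Luxemburg norm `inf { a > 0 : ∫ θ(|f|/a) dμ ≤ 1 }`, with `inf ∅ = ∞`. -/
noncomputable def luxNorm {X : Type*} [MeasurableSpace X] (μ : Measure X)
    (θ : ℝ → ℝ) (f : X → ℝ) : ℝ≥0∞ :=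
  ⨅ (a : ℝ) (_ : 0 < a) (_ : ∫⁻ x, ENNReal.ofReal (θ (|f x| / a)) ∂μ ≤ 1),
    ENNReal.ofReal a

theorem nfun_nonneg {θ : ℝ → ℝ} (hθ : IsNFunction θ) (x : ℝ) : 0 ≤ θ x := by
  obtain ⟨-, hc, he, h0, -, -⟩ := hθ
  have := hc.2 (Set.mem_univ x) (Set.mem_univ (-x)) 
    (show (0:ℝ) ≤ 1/2 by norm_num) (show (0:ℝ) ≤ 1/2 by norm_num) (by norm_num)
  simp only [smul_eq_mul, he] at this
  have h1 : (1/2 * x + 1/2 * -x : ℝ) = 0 := by ring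
  rw [h1, h0] at this
  linarith

theorem nfun_mono {θ : ℝ → ℝ} (hθ : IsNFunction θ) {a b : ℝ} (ha : 0 ≤ a) (hab : a ≤ b) :
    θ a ≤ θ b := by
  have hn := nfun_nonneg hθ b
  obtain ⟨-, hc, he, h0, -, -⟩ := hθ
  rcases eq_or_lt_of_le (ha.trans hab) with hb | hb
  · have : a = b := by linarith
    rw [this]
  · have hl : a / b ≤ 1 := (div_le_one hb).2 hab
    have hp : 0 ≤ a / b := by positivity
    have := hc.2 (Set.mem_univ b) (Set.mem_univ 0) 
      hp (show 0 ≤ 1 - a / b by linarith) (by ring)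
    simp only [smul_eq_mul, h0, mul_zero, add_zero] at this
    rw [div_mul_cancel₀ _ hb.ne'] at this
    nlinarith

theorem halving_subset {X : Type*} [MeasurableSpace X] (μ : Measure X)
    (hatom : ∀ s : Set X, MeasurableSet s → 0 < μ s →
      ∃ t ⊆ s, MeasurableSet t ∧ 0 < μ t ∧ μ t < μ s)
    (A : Set X) (hA : MeasurableSet A) (h0 : 0 < μ A) (hfin : μ A < ⊤) (n : ℕ) :
    ∃ C ⊆ A, MeasurableSet C ∧ 0 < μ C ∧ 2 ^ n * μ C ≤ μ A := by
  induction n with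
  | zero => exact ⟨A, subset_rfl, hA, h0, by simp⟩
  | succ n ih =>
    obtain ⟨C, hCA, hC, hC0, hCn⟩ := ih
    obtain ⟨t, htC, ht, ht0, htl⟩ := hatom C hC hC0
    have hadd : μ t + μ (C \ t) = μ C := by
      have := measure_inter_add_diff (μ := μ) C ht
      rwa [Set.inter_eq_right.2 htC] at this
    rcases le_total (μ t) (μ (C \ t)) with h | h
    · refine ⟨t, htC.trans hCA, ht, ht0, le_trans ?_ hCn⟩
      rw [pow_succ, mul_assoc, two_mul]
      gcongr
      rw [← hadd]; gcongr
    · refine ⟨C \ t, Set.sdiff_subset.trans hCA, hC.diff ht, ?_, le_trans ?_ hCn⟩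
      · rw [pos_iff_ne_zero]
        intro hz
        rw [hz, add_zero] at hadd
        exact htl.ne hadd
      · rw [pow_succ, mul_assoc, two_mul]
        gcongr
        rw [← hadd]; gcongr

theorem halving_subset' {X : Type*} [MeasurableSpace X] (μ : Measure X)
    (hatom : ∀ s : Set X, MeasurableSet s → 0 < μ s →
      ∃ t ⊆ s, MeasurableSet t ∧ 0 < μ t ∧ μ t < μ s)
    (A : Set X) (hA : MeasurableSet A) (h0 : 0 < μ A) (hfin : μ A < ⊤)
    (r : ℝ≥0∞) (hr : 0 < r) :
    ∃ C ⊆ A, MeasurableSet C ∧ 0 < μ C ∧ μ C ≤ r := by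
  obtain ⟨n, hn⟩ := ENNReal.exists_nat_mul_gt hr.ne' hfin.ne
  obtain ⟨C, hCA, hC, hC0, hCn⟩ := halving_subset μ hatom A hA h0 hfin n
  refine ⟨C, hCA, hC, hC0, ?_⟩
  by_contra! hlt
  have h2 : (n : ℝ≥0∞) ≤ 2 ^ n := by exact_mod_cast Nat.lt_two_pow_self.le
  have : (n : ℝ≥0∞) * r ≤ 2 ^ n * μ C := mul_le_mul' h2 hlt.le
  exact absurd (hn.trans_le (this.trans hCn)) (lt_irrefl _)

theorem mid_subset {X : Type*} [MeasurableSpace X] (μ : Measure X)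
    (hatom : ∀ s : Set X, MeasurableSet s → 0 < μ s →
      ∃ t ⊆ s, MeasurableSet t ∧ 0 < μ t ∧ μ t < μ s)
    (A : Set X) (hA : MeasurableSet A) (hfin : μ A < ⊤)
    (r : ℝ≥0∞) (hr : 0 < r) (hrA : r ≤ μ A) :
    ∃ B, MeasurableSet B ∧ r / 2 ≤ μ B ∧ μ B ≤ r := by
  by_contra! hcon
  have hrt : r ≠ ⊤ := (hrA.trans_lt hfin).ne
  have hcon' : ∀ B, MeasurableSet B → μ B ≤ r → μ B < r / 2 := by
    intro B hB hBr
    by_contra! h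
    exact absurd hBr (hcon B hB h).not_ge
  let 𝒞 : Set (Set X) := {B | B ⊆ A ∧ MeasurableSet B ∧ μ B ≤ r}
  have hne : (μ '' 𝒞).Nonempty := ⟨μ ∅, ∅, ⟨Set.empty_subset _, MeasurableSet.empty, by simp⟩, rfl⟩
  obtain ⟨u, -, hu, hmem⟩ := exists_seq_tendsto_sSup hne (OrderTop.bddAbove _)
  choose B hB hBu using hmem
  have hacc : ∀ n, MeasurableSet (Set.accumulate B n) ∧ μ (Set.accumulate B n) ≤ r := by
    intro n
    induction n with
    | zero => simpa [Set.accumulate_zero_nat] using (hB 0).2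
    | succ n ih =>
      rw [Set.accumulate_succ]
      refine ⟨ih.1.union (hB _).2.1, (measure_union_le _ _).trans ?_⟩
      calc _ ≤ r / 2 + r / 2 := add_le_add (hcon' _ ih.1 ih.2).le (hcon' _ (hB _).2.1 (hB _).2.2).le
        _ = r := ENNReal.add_halves r
  let U := ⋃ n, B n
  have hUm : MeasurableSet U := MeasurableSet.iUnion fun n => (hB n).2.1
  have hUA : U ⊆ A := Set.iUnion_subset fun n => (hB n).1
  have hUr : μ U ≤ r := by
    have : U = ⋃ n, Set.accumulate B n := (Set.iUnion_accumulate).symm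
    rw [this, Set.monotone_accumulate.measure_iUnion]
    exact iSup_le fun n => (hacc n).2
  have hUh := hcon' U hUm hUr
  have hsU : sSup (μ '' 𝒞) ≤ μ U := by
    refine le_of_tendsto' hu fun n => ?_
    rw [← hBu n]
    exact measure_mono (Set.subset_iUnion B n)
  have hUA' : μ U < μ A := hUh.trans_le (ENNReal.half_le_self.trans hrA)
  have hpos : 0 < μ (A \ U) := by
    rw [measure_sdiff hUA hUm.nullMeasurableSet (hUr.trans_lt hrt.lt_top).ne]
    exact tsub_pos_of_lt hUA'
  obtain ⟨C, hCA, hC, hC0, hCr⟩ := halving_subset' μ hatom (A \ U) (hA.diff hUm) hpos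
    ((measure_mono Set.sdiff_subset).trans_lt hfin) (r / 2) (ENNReal.half_pos hr.ne')
  have hdisj : Disjoint U C := Set.disjoint_of_subset_right hCA Set.disjoint_sdiff_right
  have hUC : μ (U ∪ C) = μ U + μ C := measure_union hdisj hC
  have hmemU : U ∪ C ∈ 𝒞 := by
    refine ⟨Set.union_subset hUA (hCA.trans Set.sdiff_subset), hUm.union hC, ?_⟩
    rw [hUC]
    calc _ ≤ r / 2 + r / 2 := add_le_add hUh.le hCr
      _ = r := ENNReal.add_halves r
  have h1 : μ (U ∪ C) ≤ μ U := (le_sSup (Set.mem_image_of_mem μ hmemU)).trans hsU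
  rw [hUC] at h1
  have h2 := ENNReal.lt_add_right (hUr.trans_lt hrt.lt_top).ne hC0.ne'
  exact absurd h1 h2.not_ge

/-- If `μ` is nonatomic with a set of finite positive measure and `θ` fails the
Δ₂-condition, then the Orlicz class is not closed under multiplication by 2. -/
theorem orliczClass_not_linear_of_not_delta2 {X : Type*} [MeasurableSpace X] (μ : Measure X)
    (hatom : ∀ s : Set X, MeasurableSet s → 0 < μ s →
      ∃ t ⊆ s, MeasurableSet t ∧ 0 < μ t ∧ μ t < μ s)
    (hE : ∃ E : Set X, MeasurableSet E ∧ 0 < μ E ∧ μ E < ⊤)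
    (θ : ℝ → ℝ) (hθ : IsNFunction θ)
    (hΔ₂ : ∀ k > (0 : ℝ), ∀ x₀ ≥ (0 : ℝ), ∃ x ≥ x₀, θ (2 * x) > k * θ x) :
    ∃ f : X → ℝ, Measurable f ∧
      ∫⁻ x, ENNReal.ofReal (θ |f x|) ∂μ < ⊤ ∧
      ∫⁻ x, ENNReal.ofReal (θ (2 * |f x|)) ∂μ = ⊤ := by
  obtain ⟨E, hEm, hE0, hEt⟩ := hE
  have hnn := nfun_nonneg hθ
  obtain ⟨c, hc⟩ : ∃ c : ℝ, c = (μ E).toReal := ⟨_, rfl⟩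
  have hc0 : 0 < c := hc ▸ ENNReal.toReal_pos hE0.ne' hEt.ne
  have hcE : ENNReal.ofReal c = μ E := by rw [hc, ENNReal.ofReal_toReal hEt.ne]
  have hbig : ∃ M : ℝ, 0 ≤ M ∧ ∀ u ≥ M, 1 ≤ θ u := by
    have h := hθ.2.2.2.2.2.eventually_ge_atTop 1
    obtain ⟨M, hM⟩ := eventually_atTop.1 h
    refine ⟨max M 1, le_max_of_le_right zero_le_one, fun u hu => ?_⟩
    have h1 : 1 ≤ u := (le_max_right _ _).trans hu
    have h2 := hM u ((le_max_left _ _).trans hu)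
    rw [le_div_iff₀ (by linarith)] at h2
    linarith
  obtain ⟨M, hM0, hM⟩ := hbig
  choose x hxM hx using fun n : ℕ => hΔ₂ (4 ^ n) (by positivity) M hM0
  have hx0 : ∀ n, 0 ≤ x n := fun n => hM0.trans (hxM n)
  have hθx : ∀ n, 1 ≤ θ (x n) := fun n => hM _ (hxM n)
  have hF : ∀ n : ℕ, ∃ B, MeasurableSet B ∧ ENNReal.ofReal ((1/2)^n * c / θ (x n)) / 2 ≤ μ B ∧
      μ B ≤ ENNReal.ofReal ((1/2)^n * c / θ (x n)) := by
    intro n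
    have hp : 0 < θ (x n) := by linarith [hθx n]
    refine mid_subset μ hatom E hEm hEt _ (ENNReal.ofReal_pos.2 (by positivity)) ?_
    rw [← hcE]
    apply ENNReal.ofReal_le_ofReal
    rw [div_le_iff₀ hp]
    have h1 : ((1:ℝ)/2)^n ≤ 1 := pow_le_one₀ (by norm_num) (by norm_num)
    have := hθx n
    nlinarith
  choose F hFm hFl hFu using hF
  have hgeo : Summable fun n : ℕ => ((1:ℝ)/2)^n * c :=
    (summable_geometric_of_lt_one (by norm_num) (by norm_num)).mul_right c
  have hint : ∑' n, ENNReal.ofReal (θ (x n)) * μ (F n) < ⊤ := by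
    refine lt_of_le_of_lt (ENNReal.tsum_le_tsum (g := fun n => ENNReal.ofReal ((1/2)^n * c)) ?_)
      hgeo.tsum_ofReal_lt_top
    intro n
    have hp : 0 < θ (x n) := by linarith [hθx n]
    calc _ ≤ ENNReal.ofReal (θ (x n)) * ENNReal.ofReal ((1/2)^n * c / θ (x n)) := by
          gcongr; exact hFu n
      _ = _ := by rw [← ENNReal.ofReal_mul hp.le, mul_div_cancel₀ _ hp.ne']
  have hsum : ∑' n, μ (F n) ≠ ⊤ := by
    refine (lt_of_le_of_lt (ENNReal.tsum_le_tsum fun n => ?_) hint).ne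
    exact le_mul_of_one_le_left (zero_le) (by simpa using hθx n)
  have hae : ∀ᵐ y ∂μ, {n | y ∈ F n}.Finite := ae_finite_setOfPred_mem hsum
  let f : X → ℝ := fun y => ⨆ n, (F n).indicator (fun _ => x n) y
  have hkey : ∀ y, {n | y ∈ F n}.Finite →
      (∃ n, f y = (F n).indicator (fun _ => x n) y) ∧
      ∀ n, (F n).indicator (fun _ => x n) y ≤ f y := by
    intro y hy
    have hr : (Set.range fun n => (F n).indicator (fun _ => x n) y).Finite := by
      refine ((hy.image x).union (Set.finite_singleton 0)).subset ?_
      rintro _ ⟨n, rfl⟩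
      by_cases h : y ∈ F n
      · left; exact ⟨n, h, by simp [h]⟩
      · right; simp [h]
    constructor
    · obtain ⟨n, hn⟩ := (Set.range_nonempty _).csSup_mem hr
      exact ⟨n, hn.symm⟩
    · exact fun n => le_ciSup hr.bddAbove n
  refine ⟨f, Measurable.iSup fun n => measurable_const.indicator (hFm n), ?_, ?_⟩
  · refine lt_of_le_of_lt ?_ hint
    calc _ ≤ ∫⁻ y, ∑' n, (F n).indicator (fun _ => ENNReal.ofReal (θ (x n))) y ∂μ := by
          refine lintegral_mono_ae ?_
          filter_upwards [hae] with y hy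
          obtain ⟨⟨n, hn⟩, -⟩ := hkey y hy
          refine le_trans ?_ (ENNReal.le_tsum n)
          rw [hn]
          by_cases h : y ∈ F n
          · simp [h, abs_of_nonneg (hx0 n)]
          · simp [h, hθ.2.2.2.1]
      _ = _ := by
          rw [lintegral_tsum fun n => (measurable_const.indicator (hFm n)).aemeasurable]
          congr 1; ext n
          rw [lintegral_indicator_const (hFm n)]
  · have hlow : ∀ n : ℕ, ENNReal.ofReal (2 ^ n * c / 2) ≤
        ∫⁻ y, ENNReal.ofReal (θ (2 * |f y|)) ∂μ := by
      intro n
      have hp : 0 < θ (x n) := by linarith [hθx n]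
      calc _ ≤ ENNReal.ofReal (θ (2 * x n)) * μ (F n) := by
            refine le_trans ?_ (mul_le_mul' (ENNReal.ofReal_le_ofReal (hx n).le) (hFl n))
            have h2 : (2 : ℝ≥0∞) = ENNReal.ofReal 2 := by simp
            rw [h2, ← ENNReal.ofReal_div_of_pos (by norm_num), ← ENNReal.ofReal_mul (by positivity)]
            apply ENNReal.ofReal_le_ofReal
            apply le_of_eq
            have h4 : (4:ℝ)^n = 2^n * 2^n := by rw [← mul_pow]; norm_num
            rw [h4, one_div, inv_pow]
            field_simp
        _ = ∫⁻ y, (F n).indicator (fun _ => ENNReal.ofReal (θ (2 * x n))) y ∂μ := by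
            rw [lintegral_indicator_const (hFm n)]
        _ ≤ _ := by
            refine lintegral_mono_ae ?_
            filter_upwards [hae] with y hy
            by_cases h : y ∈ F n
            · have h3 := (hkey y hy).2 n
              simp only [h, Set.indicator_of_mem] at h3 ⊢
              apply ENNReal.ofReal_le_ofReal
              apply nfun_mono hθ (by linarith [hx0 n])
              linarith [le_abs_self (f y)]
            · simp [h]
    rw [eq_top_iff]
    have ht : Tendsto (fun n : ℕ => ENNReal.ofReal (2 ^ n * c / 2)) atTop (𝓝 ⊤) := by
      apply ENNReal.tendsto_ofReal_atTop.comp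
      apply Tendsto.atTop_div_const (by norm_num)
      exact (tendsto_pow_atTop_atTop_of_one_lt (by norm_num)).atTop_mul_const hc0
    exact le_of_tendsto' ht hlow
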